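/- Let d ∈ ℕ, τ ≥ d+1, and n ≥ τ⁴. Let K ~ Multinomial(n,p) and U ~ Uniform(−1/2,1/2)^d be independent, set X := K + U, let P̃_{n,p} be the law of X, and let Q_{n,p} be the law of the multivariate normal Normal_d(n p, n Σ_p). Then sup_{p ∈ P_τ} ‖P̃_{n,p} − Q_{n,p}‖ ≤ 8.03 τ^{3/2} (d+1)^{1/2} / n^{1/2}, where ‖·‖ denotes the total variation norm. -/

import Mathlib

open MeasureTheory Matrix Real Finset
open scoped BigOperators ENNReal NNReal

noncomputable section

/-- Extended probability vector: `p` on `Fin d`, together with `p (d+1) = 1 - ∑ p`. -/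
def extP (d : ℕ) (p : Fin d → ℝ) : Fin (d + 1) → ℝ :=
  Fin.snoc p (1 - ∑ i, p i)

/-- Extended coordinate vector: `v` on `Fin d`, together with `v (d+1) = n - ∑ v`. -/
def extV (d n : ℕ) (v : Fin d → ℝ) : Fin (d + 1) → ℝ :=
  Fin.snoc v ((n : ℝ) - ∑ i, v i)

/-- `δ_{y,q} = (y - n q) / √n`. -/
def del (n : ℕ) (q y : ℝ) : ℝ := (y - n * q) / Real.sqrt n

/-- The vector `δ_{v,p}`. -/
def delVec (d n : ℕ) (p v : Fin d → ℝ) : Fin d → ℝ := fun i => del n (p i) (v i)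

/-- The covariance matrix `Σ_p = diag p - p pᵀ`. -/
def covM (d : ℕ) (p : Fin d → ℝ) : Matrix (Fin d) (Fin d) ℝ :=
  Matrix.diagonal p - Matrix.vecMulVec p p

/-- The quadratic form `x ↦ xᵀ Σ_p⁻¹ x`. -/
def quadForm (d : ℕ) (p x : Fin d → ℝ) : ℝ := x ⬝ᵥ ((covM d p)⁻¹ *ᵥ x)

/-- The Gaussian density `φ_{Σ_p}`. -/
def gaussDens (d : ℕ) (p y : Fin d → ℝ) : ℝ :=
  Real.exp (-(1 / 2) * quadForm d p y) /
    Real.sqrt ((2 * Real.pi) ^ d * ∏ i, extP d p i)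

/-- The `Multinomial(n, p)` probability mass function. -/
def multinomialPMF (d n : ℕ) (p : Fin d → ℝ) (k : Fin d → ℕ) : ℝ :=
  if ∑ i, k i ≤ n then
    ((n.factorial : ℝ) / ((∏ i, ((k i).factorial : ℝ)) * ((n - ∑ i, k i).factorial : ℝ))) *
      ((∏ i, p i ^ k i) * (1 - ∑ i, p i) ^ (n - ∑ i, k i))
  else 0

/-- The interior `S_d^o` of the unit simplex. -/
def simplexInt (d : ℕ) : Set (Fin d → ℝ) :=
  {s | (∀ i, s i ∈ Set.Ioo (0 : ℝ) 1) ∧ ∑ i, s i < 1}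

/-- The set `P_τ`. -/
def Ptau (d : ℕ) (τ : ℝ) : Set (Fin d → ℝ) :=
  {s | s ∈ simplexInt d ∧ ∀ i : Fin (d + 1), (extP d s i)⁻¹ ≤ τ}

/-- Cast a vector of naturals to a real vector. -/
def castK (d : ℕ) (k : Fin d → ℕ) : Fin d → ℝ := fun i => (k i : ℝ)

/-- The bulk set `B_{n,p}` (integer vectors). -/
def bulk (d n : ℕ) (τ : ℝ) (p : Fin d → ℝ) : Set (Fin d → ℕ) :=
  {k | (∀ i, 0 < k i) ∧ ∑ i, k i < n ∧
    ∀ i : Fin (d + 1),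
      |del n (extP d p i) (extV d n (castK d k) i) / (Real.sqrt n * extP d p i)| ≤
        τ * Real.sqrt (Real.log n / n)}

/-- The bulk set `B_{n,p}` (real vectors). -/
def bulkReal (d n : ℕ) (τ : ℝ) (p : Fin d → ℝ) : Set (Fin d → ℝ) :=
  {x | ∀ i : Fin (d + 1),
    |del n (extP d p i) (extV d n x i) / (Real.sqrt n * extP d p i)| ≤
      τ * Real.sqrt (Real.log n / n)}

/-- The main term in the local expansion. -/
def mainTerm (d n : ℕ) (p v : Fin d → ℝ) : ℝ :=
  (n : ℝ) ^ (-(1 : ℝ) / 2) * ∑ i : Fin (d + 1),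
    (del n (extP d p i) (extV d n v i) ^ 3 / (6 * extP d p i ^ 2) -
      del n (extP d p i) (extV d n v i) / (2 * extP d p i))

/-- The bound on the remainder `R_{n,p}(k)`. -/
def errBound (d n : ℕ) (τ : ℝ) (p v : Fin d → ℝ) : ℝ :=
  (n : ℝ)⁻¹ * ∑ i : Fin (d + 1),
    (21 * |del n (extP d p i) (extV d n v i)| ^ 4 / extP d p i ^ 3 +
      10 * |del n (extP d p i) (extV d n v i)| ^ 2 / extP d p i ^ 2 + 2 * τ / 3)

/-- The log-ratio of the multinomial pmf over the corresponding normal density. -/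
def logRatio (d n : ℕ) (p : Fin d → ℝ) (k : Fin d → ℕ) : ℝ :=
  Real.log (multinomialPMF d n p k /
    ((n : ℝ) ^ (-(d : ℝ) / 2) * gaussDens d p (delVec d n p (castK d k))))

/-- The law of a `Multinomial(n,p)` random vector, as a measure on `ℝ^d`. -/
def multinomialLaw (d n : ℕ) (p : Fin d → ℝ) : Measure (Fin d → ℝ) :=
  Measure.sum fun k : Fin d → ℕ =>
    ENNReal.ofReal (multinomialPMF d n p k) • Measure.dirac (castK d k)

/-- The law of a `Uniform(-1/2,1/2)^d` random vector. -/
def uniformBoxLaw (d : ℕ) : Measure (Fin d → ℝ) :=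
  volume.restrict (Set.univ.pi fun _ : Fin d => Set.Ioo (-(1 : ℝ) / 2) (1 / 2))

/-- The law of a `Normal_d (n p, n Σ_p)` random vector. -/
def gaussLaw (d n : ℕ) (p : Fin d → ℝ) : Measure (Fin d → ℝ) :=
  volume.withDensity fun y =>
    ENNReal.ofReal ((n : ℝ) ^ (-(d : ℝ) / 2) * gaussDens d p (delVec d n p y))

/-- The regularized lower incomplete gamma function `γ̄(x, a)`. -/
def regGamma (x a : ℝ) : ℝ :=
  (∫ t in (0 : ℝ)..a, t ^ (x - 1) * Real.exp (-t)) / Real.Gamma x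

/-- Robbins' upper bound in Stirling's formula. -/
lemma log_factorial_le_stirling {n : ℕ} (hn : n ≠ 0) :
    log (n.factorial : ℝ) ≤ n * log n - n + log n / 2 + log (2 * π) / 2 + 1 / (12 * n) := by
  have hmono : Monotone fun k : ℕ =>
      log (Stirling.stirlingSeq (k + 1)) - 1 / (12 * ((k : ℝ) + 1)) := by
    refine monotone_nat_of_le_succ fun k => ?_
    have h := Stirling.log_stirlingSeq_sdiff_le (k + 1)
    have e : (1 : ℝ) / (12 * ((k + 1 : ℕ) : ℝ) * (((k + 1 : ℕ) : ℝ) + 1))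
        = 1 / (12 * ((k : ℝ) + 1)) - 1 / (12 * (((k + 1 : ℕ) : ℝ) + 1)) := by
      push_cast
      field_simp
      ring
    rw [e] at h
    linarith
  have hlim : Filter.Tendsto
      (fun k : ℕ => log (Stirling.stirlingSeq (k + 1)) - 1 / (12 * ((k : ℝ) + 1)))
      Filter.atTop (nhds (log (√π) - 0)) := by
    refine Filter.Tendsto.sub ?_ ?_
    · have h1 := (Filter.tendsto_add_atTop_iff_nat 1).2 Stirling.tendsto_stirlingSeq_sqrt_pi
      exact ((Real.continuousAt_log (by positivity)).tendsto.comp h1)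
    · have := (tendsto_one_div_add_atTop_nhds_zero_nat (𝕜 := ℝ)).const_mul (1 / 12)
      simp only [mul_zero] at this
      refine this.congr fun k => ?_
      field_simp
  obtain ⟨k, rfl⟩ := Nat.exists_eq_succ_of_ne_zero hn
  have h := hmono.ge_of_tendsto hlim k
  simp only [Stirling.log_stirlingSeq_formula] at h
  have hk : (0 : ℝ) < ((k + 1 : ℕ) : ℝ) := by positivity
  rw [log_div hk.ne' (exp_pos 1).ne', log_exp, log_mul two_ne_zero hk.ne',
    log_sqrt pi_pos.le] at h
  simp only [Nat.succ_eq_add_one]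
  rw [log_mul two_ne_zero pi_pos.ne']
  push_cast at h ⊢
  linarith

/-- The normalized form of `cubic_taylor_le_mul_log`. -/
lemma cubic_taylor_div_le_log {t : ℝ} (ht : 0 < t) :
    ((t - 1) + (t - 1) ^ 2 / 2 - (t - 1) ^ 3 / 6) / t ≤ log t := by
  let h : ℝ → ℝ := fun t => log t - ((t - 1) + (t - 1) ^ 2 / 2 - (t - 1) ^ 3 / 6) / t
  have hd : ∀ t : ℝ, 0 < t → HasDerivAt h ((t - 1) ^ 3 / 3 / t ^ 2) t := by
    intro t ht
    have h1 : HasDerivAt (fun t : ℝ => t - 1) 1 t := (hasDerivAt_id t).sub_const 1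
    have h2 := ((h1.add ((h1.pow 2).div_const 2)).sub ((h1.pow 3).div_const 6)).div
      (hasDerivAt_id t) ht.ne'
    have h3 := (Real.hasDerivAt_log ht.ne').sub h2
    refine h3.congr_deriv ?_
    simp only [Pi.add_apply, Pi.sub_apply, Pi.pow_apply, id]
    field_simp
    ring
  have h1 : h 1 = 0 := by simp [h]
  suffices 0 ≤ h t by
    simp only [h] at this
    linarith
  rw [← h1]
  rcases le_total t 1 with ht1 | ht1
  · have ha : AntitoneOn h (Set.Icc t 1) := by
      refine antitoneOn_of_hasDerivWithinAt_nonpos (f' := fun t => (t - 1) ^ 3 / 3 / t ^ 2)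
        (convex_Icc t 1) ?_ ?_ ?_
      · intro x hx
        exact (hd x (ht.trans_le hx.1)).continuousAt.continuousWithinAt
      · intro x hx
        rw [interior_Icc] at hx
        exact (hd x (ht.trans hx.1)).hasDerivWithinAt
      · intro x hx
        rw [interior_Icc] at hx
        have : (x - 1) ^ 3 ≤ 0 := Odd.pow_nonpos (by decide) (by linarith [hx.2])
        exact div_nonpos_of_nonpos_of_nonneg (by linarith) (sq_nonneg x)
    exact ha ⟨le_rfl, ht1⟩ ⟨ht1, le_rfl⟩ ht1
  · have ha : MonotoneOn h (Set.Icc 1 t) := by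
      refine monotoneOn_of_hasDerivWithinAt_nonneg (f' := fun t => (t - 1) ^ 3 / 3 / t ^ 2)
        (convex_Icc 1 t) ?_ ?_ ?_
      · intro x hx
        exact (hd x (one_pos.trans_le hx.1)).continuousAt.continuousWithinAt
      · intro x hx
        rw [interior_Icc] at hx
        exact (hd x (one_pos.trans hx.1)).hasDerivWithinAt
      · intro x hx
        rw [interior_Icc] at hx
        have : 0 ≤ (x - 1) ^ 3 := pow_nonneg (by linarith [hx.1]) 3
        positivity
    exact ha ⟨le_rfl, ht1⟩ ⟨ht1, le_rfl⟩ ht1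

/-- The cubic Taylor polynomial of `x log x` at `a` is a global lower bound. -/
lemma cubic_taylor_le_mul_log {a x : ℝ} (ha : 0 < a) (hx : 0 < x) :
    a * log a + (1 + log a) * (x - a) + (x - a) ^ 2 / (2 * a) - (x - a) ^ 3 / (6 * a ^ 2)
      ≤ x * log x := by
  have h := mul_le_mul_of_nonneg_left (cubic_taylor_div_le_log (div_pos hx ha)) hx.le
  rw [log_div hx.ne' ha.ne'] at h
  have e : x * (((x / a - 1) + (x / a - 1) ^ 2 / 2 - (x / a - 1) ^ 3 / 6) / (x / a))
      = (x - a) + (x - a) ^ 2 / (2 * a) - (x - a) ^ 3 / (6 * a ^ 2) := by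
    field_simp
  rw [e] at h
  linarith

/-- Lower bound for `log k!` that is regular at `k = 0`. -/
lemma le_log_factorial_shifted (k : ℕ) :
    ((k : ℝ) + 1) * log (k + 1) - (k + 1) - log (k + 1) / 2 + log (2 * π) / 2
      ≤ log (k.factorial : ℝ) := by
  have h := Stirling.le_log_factorial_stirling (n := k + 1) (by omega)
  rw [Nat.factorial_succ, Nat.cast_mul,
    log_mul (x := ((k + 1 : ℕ) : ℝ)) (by positivity) (by positivity)] at h
  simp only [Nat.cast_add, Nat.cast_one] at h
  linarith

/-- Jensen-type lower bound for the expectation of `log X!` under the first three moments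
of a binomial variable. -/
lemma le_sum_log_factorial {ι : Type*} (s : Finset ι) (w : ι → ℝ) (X : ι → ℕ) (x p : ℝ)
    (hw : ∀ k ∈ s, 0 ≤ w k) (hx : 0 < x) (hp0 : 0 ≤ p) (hp1 : p ≤ 1)
    (h0 : ∑ k ∈ s, w k = 1) (h1 : ∑ k ∈ s, w k * ((X k : ℝ) - x) = 0)
    (h2 : ∑ k ∈ s, w k * ((X k : ℝ) - x) ^ 2 = x * (1 - p))
    (h3 : ∑ k ∈ s, w k * ((X k : ℝ) - x) ^ 3 = x * (1 - p) * (1 - 2 * p)) :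
    (x + 1 / 2) * log x - x + log (2 * π) / 2 + (1 - p) / 2 - 2 / (3 * x)
      ≤ ∑ k ∈ s, w k * log ((X k).factorial : ℝ) := by
  set a := x + 1 with ha
  have ha0 : 0 < a := by positivity
  have hpt : ∀ k ∈ s, w k * (a * log a + (1 + log a) * (X k - x) + (X k - x) ^ 2 / (2 * a)
      - (X k - x) ^ 3 / (6 * a ^ 2) - (X k - x) - a - (log a + (X k - x) / a) / 2 + log (2 * π) / 2)
      ≤ w k * log ((X k).factorial : ℝ) := by
    intro k hk
    refine mul_le_mul_of_nonneg_left ?_ (hw k hk)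
    have hk0 : (0 : ℝ) < X k + 1 := by positivity
    have e1 := cubic_taylor_le_mul_log ha0 hk0
    have e2 := le_log_factorial_shifted (X k)
    have e3 : log ((X k : ℝ) + 1) ≤ log a + (X k - x) / a := by
      have := Real.log_le_sub_one_of_pos (div_pos hk0 ha0)
      rw [log_div hk0.ne' ha0.ne'] at this
      have e : (X k - x) / a = (X k + 1) / a - 1 := by
        field_simp
        rw [ha]; ring
      linarith
    have e4 : (X k : ℝ) + 1 - a = X k - x := by rw [ha]; ring
    rw [e4] at e1
    linarith
  refine le_trans ?_ (Finset.sum_le_sum hpt)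
  have hs : ∑ k ∈ s, w k * (a * log a + (1 + log a) * (X k - x) + (X k - x) ^ 2 / (2 * a)
      - (X k - x) ^ 3 / (6 * a ^ 2) - (X k - x) - a - (log a + (X k - x) / a) / 2 + log (2 * π) / 2)
      = (a * log a - a - log a / 2 + log (2 * π) / 2) * ∑ k ∈ s, w k
        + (log a - 1 / (2 * a)) * ∑ k ∈ s, w k * ((X k : ℝ) - x)
        + 1 / (2 * a) * ∑ k ∈ s, w k * ((X k : ℝ) - x) ^ 2
        - 1 / (6 * a ^ 2) * ∑ k ∈ s, w k * ((X k : ℝ) - x) ^ 3 := by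
    simp only [Finset.mul_sum, ← Finset.sum_add_distrib, ← Finset.sum_sub_distrib]
    refine Finset.sum_congr rfl fun k _ => ?_
    field_simp
    ring
  rw [hs, h0, h1, h2, h3]
  have hlog : log x + 2 / (2 * x + 1) ≤ log a := by
    have := Real.le_log_one_add_of_nonneg (x := 1 / x) (by positivity)
    have e : 1 + 1 / x = a / x := by rw [ha]; field_simp
    have e' : 2 * (1 / x) / (1 / x + 2) = 2 / (2 * x + 1) := by field_simp; ring
    rw [e, log_div ha0.ne' hx.ne', e'] at this
    linarith
  have hlog' : (x + 1 / 2) * log x + 1 ≤ (x + 1 / 2) * log a := by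
    have := mul_le_mul_of_nonneg_left hlog (by positivity : 0 ≤ x + 1 / 2)
    have e : (x + 1 / 2) * (2 / (2 * x + 1)) = 1 := by field_simp
    rw [mul_add, e] at this
    exact this
  have hq : 1 / (2 * a) * (x * (1 - p)) - 1 / (6 * a ^ 2) * (x * (1 - p) * (1 - 2 * p))
      ≥ (1 - p) / 2 - 2 / (3 * x) := by
    have e1 : 1 / (2 * a) * (x * (1 - p)) = (1 - p) / 2 - (1 - p) / (2 * a) := by
      rw [ha]; field_simp; ring
    have e2 : (1 - p) / (2 * a) ≤ 1 / (2 * x) := by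
      apply div_le_div₀ <;> linarith
    have e3 : 1 / (6 * a ^ 2) * (x * (1 - p) * (1 - 2 * p)) ≤ 1 / (6 * x) := by
      have : x * (1 - p) * (1 - 2 * p) ≤ x := by
        nlinarith [mul_nonneg hx.le hp0, mul_nonneg (mul_nonneg hx.le hp0) (sub_nonneg.2 hp1)]
      rw [one_div_mul_eq_div, div_le_div_iff₀ (by positivity) (by positivity)]
      nlinarith [mul_pos hx hx]
    have e4 : 2 / (3 * x) = 1 / (2 * x) + 1 / (6 * x) := by field_simp; norm_num
    linarith
  have e : a * log a - a - log a / 2 = (x + 1 / 2) * log a - x - 1 := by rw [ha]; ring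
  rw [e]
  linarith

/-- The multinomial weight of a vector of counts, in symmetric coordinates. -/
def multinomialWeight {ι : Type*} [Fintype ι] (p : ι → ℝ) (κ : ι → ℕ) : ℝ :=
  Nat.multinomial univ κ * ∏ j, p j ^ κ j

open Polynomial in
lemma iterate_derivative_affine_pow (b p : ℝ) (n r : ℕ) :
    derivative^[r] ((C b + C p * X) ^ n)
      = C ((n.descFactorial r : ℝ) * p ^ r) * (C b + C p * X) ^ (n - r) := by
  induction r with
  | zero => simp
  | succ r ih =>
    rw [Function.iterate_succ_apply', ih, derivative_C_mul, derivative_pow, Nat.descFactorial_succ]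
    simp only [derivative_add, derivative_C, derivative_mul, derivative_X, zero_mul, zero_add,
      mul_one, Nat.sub_sub, Nat.cast_mul, map_mul, map_pow, map_natCast]
    ring

section moments

variable {ι : Type*} [Fintype ι] [DecidableEq ι] {p : ι → ℝ}

open Polynomial in
lemma sum_multinomialWeight_mul_X_pow (n : ℕ) (p : ι → ℝ) (i : ι) :
    ∑ κ ∈ piAntidiag univ n, C (multinomialWeight p κ) * X ^ κ i
      = (C (∑ j, p j - p i) + C (p i) * X) ^ n := by
  have h := Finset.sum_pow_eq_sum_piAntidiag univ
    (fun j => C (p j) * (if j = i then X else 1 : ℝ[X])) n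
  have hs : ∑ j, C (p j) * (if j = i then X else 1 : ℝ[X])
      = C (∑ j, p j - p i) + C (p i) * X := by
    rw [← Finset.add_sum_erase _ _ (Finset.mem_univ i),
      ← Finset.add_sum_erase univ p (Finset.mem_univ i)]
    rw [Finset.sum_congr rfl (g := fun j => C (p j))
      (fun j hj => by simp [(Finset.mem_erase.1 hj).1])]
    simp [add_comm]
  rw [hs] at h
  rw [h]
  refine Finset.sum_congr rfl fun κ _ => ?_
  simp only [mul_pow, Finset.prod_mul_distrib, ite_pow, one_pow, multinomialWeight, map_mul,
    map_natCast, map_prod, map_pow, Finset.prod_ite_eq', Finset.mem_univ, if_true]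
  ring

open Polynomial in
lemma sum_multinomialWeight_mul_descFactorial (n r : ℕ) (hp : ∑ j, p j = 1) (i : ι) :
    ∑ κ ∈ piAntidiag univ n, multinomialWeight p κ * ((κ i).descFactorial r : ℝ)
      = (n.descFactorial r : ℝ) * p i ^ r := by
  have h := congrArg (fun q => (derivative^[r] q).eval 1) (sum_multinomialWeight_mul_X_pow n p i)
  simp only [iterate_derivative_affine_pow, iterate_derivative_sum, eval_finsetSum,
    iterate_derivative_C_mul, iterate_derivative_X_pow_eq_natCast_mul, eval_mul, eval_C, eval_pow,
    eval_X, eval_natCast, one_pow, mul_one, eval_add, hp, sub_add_cancel] at h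
  exact h

lemma cast_descFactorial_three (n : ℕ) :
    (n.descFactorial 3 : ℝ) = n * (n - 1) * (n - 2) := by
  rcases n with _ | _ | _ | n
  · simp
  · simp
  · simp [Nat.descFactorial]
  · simp only [Nat.descFactorial_succ, Nat.descFactorial_zero, Nat.add_sub_cancel, Nat.sub_zero]
    push_cast
    ring

lemma sum_multinomialWeight (n : ℕ) (hp : ∑ j, p j = 1) (i : ι) :
    ∑ κ ∈ piAntidiag univ n, multinomialWeight p κ = 1 := by
  simpa using sum_multinomialWeight_mul_descFactorial n 0 hp i

lemma sum_multinomialWeight_mul_self (n : ℕ) (hp : ∑ j, p j = 1) (i : ι) :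
    ∑ κ ∈ piAntidiag univ n, multinomialWeight p κ * (κ i : ℝ) = n * p i := by
  simpa using sum_multinomialWeight_mul_descFactorial n 1 hp i

lemma sum_multinomialWeight_centered (n : ℕ) (hp : ∑ j, p j = 1) (i : ι) :
    ∑ κ ∈ piAntidiag univ n, multinomialWeight p κ * ((κ i : ℝ) - n * p i) = 0 := by
  simp only [mul_sub, Finset.sum_sub_distrib, ← Finset.sum_mul]
  rw [sum_multinomialWeight_mul_self n hp, sum_multinomialWeight n hp i]
  ring

lemma sum_multinomialWeight_centered_sq (n : ℕ) (hp : ∑ j, p j = 1) (i : ι) :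
    ∑ κ ∈ piAntidiag univ n, multinomialWeight p κ * ((κ i : ℝ) - n * p i) ^ 2
      = n * p i * (1 - p i) := by
  have h0 := sum_multinomialWeight n hp i
  have h1 := sum_multinomialWeight_mul_self n hp i
  have h2 := sum_multinomialWeight_mul_descFactorial n 2 hp i
  simp only [Nat.cast_descFactorial_two] at h2
  calc _ = ∑ κ ∈ piAntidiag univ n, (multinomialWeight p κ * ((κ i : ℝ) * (κ i - 1))
        + (1 - 2 * (n * p i)) * (multinomialWeight p κ * κ i)
        + (n * p i) ^ 2 * multinomialWeight p κ) := Finset.sum_congr rfl fun κ _ => by ring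
    _ = _ := by
      rw [Finset.sum_add_distrib, Finset.sum_add_distrib, ← Finset.mul_sum, ← Finset.mul_sum,
        h0, h1, h2]
      ring

lemma sum_multinomialWeight_centered_cube (n : ℕ) (hp : ∑ j, p j = 1) (i : ι) :
    ∑ κ ∈ piAntidiag univ n, multinomialWeight p κ * ((κ i : ℝ) - n * p i) ^ 3
      = n * p i * (1 - p i) * (1 - 2 * p i) := by
  have h0 := sum_multinomialWeight n hp i
  have h1 := sum_multinomialWeight_mul_self n hp i
  have h2 := sum_multinomialWeight_mul_descFactorial n 2 hp i
  have h3 := sum_multinomialWeight_mul_descFactorial n 3 hp i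
  simp only [Nat.cast_descFactorial_two] at h2
  simp only [cast_descFactorial_three] at h3
  calc _ = ∑ κ ∈ piAntidiag univ n, (multinomialWeight p κ * ((κ i : ℝ) * (κ i - 1) * (κ i - 2))
        + (3 - 3 * (n * p i)) * (multinomialWeight p κ * ((κ i : ℝ) * (κ i - 1)))
        + (1 - 3 * (n * p i) + 3 * (n * p i) ^ 2) * (multinomialWeight p κ * κ i)
        + -(n * p i) ^ 3 * multinomialWeight p κ) := Finset.sum_congr rfl fun κ _ => by ring
    _ = _ := by
      rw [Finset.sum_add_distrib, Finset.sum_add_distrib, Finset.sum_add_distrib,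
        ← Finset.mul_sum, ← Finset.mul_sum, ← Finset.mul_sum, h0, h1, h2, h3]
      ring

end moments

lemma multinomialWeight_pos {ι : Type*} [Fintype ι] {p : ι → ℝ} (hpos : ∀ i, 0 < p i)
    (κ : ι → ℕ) : 0 < multinomialWeight p κ :=
  mul_pos (by exact_mod_cast Nat.multinomial_pos univ κ)
    (Finset.prod_pos fun i _ => pow_pos (hpos i) _)

section entropy

variable {ι : Type*} [Fintype ι] [DecidableEq ι] {p : ι → ℝ}

lemma log_multinomialWeight {n : ℕ} (hpos : ∀ i, 0 < p i) {κ : ι → ℕ}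
    (hκ : κ ∈ piAntidiag univ n) :
    log (multinomialWeight p κ)
      = log (n.factorial : ℝ) - ∑ i, log ((κ i).factorial : ℝ) + ∑ i, (κ i : ℝ) * log (p i) := by
  have hsum : ∑ i, κ i = n := (mem_piAntidiag.1 hκ).1
  have hspec := Nat.multinomial_spec univ κ
  rw [hsum] at hspec
  have hspec' : (∏ i, ((κ i).factorial : ℝ)) * (Nat.multinomial univ κ : ℝ) = n.factorial := by
    exact_mod_cast hspec
  have hf : ∀ i ∈ univ, ((κ i).factorial : ℝ) ≠ 0 := fun i _ => by positivity
  have hm : (Nat.multinomial univ κ : ℝ) ≠ 0 := by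
    exact_mod_cast (Nat.multinomial_pos univ κ).ne'
  have hpp : ∀ i ∈ univ, p i ^ κ i ≠ 0 := fun i _ => (pow_pos (hpos i) _).ne'
  rw [← hspec', log_mul (Finset.prod_ne_zero_iff.2 hf) hm, log_prod hf, multinomialWeight,
    log_mul hm (Finset.prod_ne_zero_iff.2 hpp), log_prod hpp]
  simp only [log_pow]
  ring

/-- Upper bound for the negative entropy of the multinomial distribution. -/
lemma sum_multinomialWeight_mul_log_le {n : ℕ} (hn : n ≠ 0) [Nonempty ι]
    (hpos : ∀ i, 0 < p i) (hp : ∑ i, p i = 1) :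
    ∑ κ ∈ piAntidiag univ n, multinomialWeight p κ * log (multinomialWeight p κ)
      ≤ -(((Fintype.card ι : ℝ) - 1) / 2 * (log n + log (2 * π) + 1)) - (∑ i, log (p i)) / 2
        + 1 / (12 * n) + ∑ i, 2 / (3 * (n * p i)) := by
  have hn0 : (0 : ℝ) < n := by positivity
  have hfac : ∀ i, (n * p i + 1 / 2) * log (n * p i) - n * p i + log (2 * π) / 2
      + (1 - p i) / 2 - 2 / (3 * (n * p i))
      ≤ ∑ κ ∈ piAntidiag univ n, multinomialWeight p κ * log ((κ i).factorial : ℝ) := by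
    intro i
    have hp1 : p i ≤ 1 := by
      rw [← hp]
      exact Finset.single_le_sum (fun j _ => (hpos j).le) (Finset.mem_univ i)
    exact le_sum_log_factorial (piAntidiag univ n) (multinomialWeight p) (fun κ => κ i) (n * p i) (p i)
      (fun κ _ => (multinomialWeight_pos hpos κ).le) (mul_pos hn0 (hpos i)) (hpos i).le hp1
      (sum_multinomialWeight n hp i) (sum_multinomialWeight_centered n hp i)
      (sum_multinomialWeight_centered_sq n hp i) (sum_multinomialWeight_centered_cube n hp i)
  have hsum : ∑ κ ∈ piAntidiag univ n, multinomialWeight p κ * log (multinomialWeight p κ)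
      = log (n.factorial : ℝ)
        - ∑ i, ∑ κ ∈ piAntidiag univ n, multinomialWeight p κ * log ((κ i).factorial : ℝ)
        + ∑ i, n * p i * log (p i) := by
    obtain ⟨i₀⟩ := ‹Nonempty ι›
    have h1 : ∀ i, ∑ κ ∈ piAntidiag univ n, multinomialWeight p κ * ((κ i : ℝ) * log (p i))
        = n * p i * log (p i) := fun i => by
      rw [← sum_multinomialWeight_mul_self n hp i, Finset.sum_mul]
      exact Finset.sum_congr rfl fun κ _ => by ring
    rw [Finset.sum_congr rfl fun κ hκ => by rw [log_multinomialWeight hpos hκ]]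
    simp only [mul_add, mul_sub, Finset.sum_add_distrib, Finset.sum_sub_distrib, Finset.mul_sum]
    rw [← Finset.sum_mul, sum_multinomialWeight n hp i₀, one_mul, Finset.sum_comm,
      Finset.sum_comm (s := piAntidiag univ n) (t := univ)
        (f := fun κ i => multinomialWeight p κ * ((κ i : ℝ) * log (p i)))]
    simp only [h1]
  have hS := Finset.sum_le_sum fun i (_ : i ∈ univ) => hfac i
  have hst := log_factorial_le_stirling hn
  have hT : ∑ i, ((n * p i + 1 / 2) * log (n * p i) - n * p i + log (2 * π) / 2
      + (1 - p i) / 2 - 2 / (3 * (n * p i)))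
      = n * log n + ∑ i, n * p i * log (p i) + (Fintype.card ι : ℝ) * log n / 2
        + (∑ i, log (p i)) / 2 - n + (Fintype.card ι : ℝ) * log (2 * π) / 2
        + ((Fintype.card ι : ℝ) - 1) / 2 - ∑ i, 2 / (3 * (n * p i)) := by
    have : ∀ i, (n * p i + 1 / 2) * log (n * p i) - n * p i + log (2 * π) / 2
        + (1 - p i) / 2 - 2 / (3 * (n * p i))
        = p i * (n * log n - n - 1 / 2) + n * p i * log (p i) + log (p i) / 2
          + (log n / 2 + log (2 * π) / 2 + 1 / 2) - 2 / (3 * (n * p i)) := fun i => by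
      rw [log_mul hn0.ne' (hpos i).ne']
      ring
    simp only [this, Finset.sum_add_distrib, Finset.sum_sub_distrib, ← Finset.sum_mul,
      ← Finset.sum_div, hp, Finset.sum_const, Finset.card_univ, nsmul_eq_mul]
    ring
  rw [hsum]
  rw [hT] at hS
  linarith

end entropy

/-- Pointwise inequality behind Pinsker-type bounds. -/
lemma max_sub_zero_le_klFun {a b l : ℝ} (ha : 0 < a) (hb : 0 < b) (hl : 0 < l) :
    max (a - b) 0 ≤ l / 2 * a + (a * log a - a * log b - a + b) / l := by
  have hlog : log (b / a) = log b - log a := log_div hb.ne' ha.ne'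
  have hge : 0 ≤ a * log a - a * log b - a + b := by
    have h := mul_le_mul_of_nonneg_left (log_le_sub_one_of_pos (div_pos hb ha)) ha.le
    rw [hlog, mul_sub, mul_sub, mul_div_cancel₀ _ ha.ne'] at h
    linarith
  have hr : 0 ≤ (a * log a - a * log b - a + b) / l := div_nonneg hge hl.le
  have hl2 : 0 ≤ l / 2 * a := by positivity
  refine max_le ?_ (by positivity)
  rcases le_total a b with hab | hab
  · linarith
  have h := Real.le_log_one_add_of_nonneg (x := a / b - 1)
    (by rw [sub_nonneg, le_div_iff₀ hb]; linarith)
  rw [add_sub_cancel, log_div ha.ne' hb.ne'] at h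
  have e : 2 * (a / b - 1) / (a / b - 1 + 2) = 2 * (a - b) / (a + b) := by
    have : a + b ≠ 0 := by positivity
    have h' : a / b - 1 + 2 ≠ 0 := by
      have : a / b - 1 + 2 = (a + b) / b := by field_simp; ring
      rw [this]; positivity
    field_simp
    ring
  rw [e] at h
  have h2 : (a - b) ^ 2 / (2 * a) ≤ a * log a - a * log b - a + b := by
    have h3 := mul_le_mul_of_nonneg_left h ha.le
    have h4 : (a - b) ^ 2 / (2 * a) + a - b ≤ a * (2 * (a - b) / (a + b)) := by
      have e2 : a * (2 * (a - b) / (a + b)) - ((a - b) ^ 2 / (2 * a) + a - b)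
          = (a - b) ^ 3 / (2 * a * (a + b)) := by
        have : a + b ≠ 0 := by positivity
        field_simp
        ring
      have : 0 ≤ (a - b) ^ 3 / (2 * a * (a + b)) :=
        div_nonneg (pow_nonneg (by linarith) 3) (by positivity)
      linarith
    linarith
  have h5 : (a - b) ^ 2 / (2 * a) / l ≤ (a * log a - a * log b - a + b) / l := by gcongr
  have h6 : a - b ≤ l / 2 * a + (a - b) ^ 2 / (2 * a) / l := by
    have : l / 2 * a + (a - b) ^ 2 / (2 * a) / l - (a - b) = (a * l - (a - b)) ^ 2 / (2 * a * l) := by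
      field_simp
      ring
    have : 0 ≤ (a * l - (a - b)) ^ 2 / (2 * a * l) := by positivity
    linarith
  linarith

lemma extP_sum (d : ℕ) (p : Fin d → ℝ) : ∑ i, extP d p i = 1 := by
  simp [extP, Fin.sum_univ_castSucc]

lemma extP_pos {d : ℕ} {p : Fin d → ℝ} (hp : p ∈ simplexInt d) (i : Fin (d + 1)) :
    0 < extP d p i := by
  refine Fin.lastCases ?_ (fun i => ?_) i
  · simp only [extP, Fin.snoc_last]
    linarith [hp.2]
  · simp only [extP, Fin.snoc_castSucc]
    exact (hp.1 i).1

lemma multinomialPMF_init {d n : ℕ} (p : Fin d → ℝ) {κ : Fin (d + 1) → ℕ}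
    (hκ : κ ∈ piAntidiag univ n) :
    multinomialPMF d n p (Fin.init κ) = multinomialWeight (extP d p) κ := by
  have hsum : ∑ i, κ i = n := (mem_piAntidiag.1 hκ).1
  have hs : ∑ i, Fin.init κ i + κ (Fin.last d) = n := by
    rw [← hsum, Fin.sum_univ_castSucc]
    rfl
  have hspec := Nat.multinomial_spec univ κ
  rw [hsum] at hspec
  have hlast : n - ∑ i, Fin.init κ i = κ (Fin.last d) := by omega
  rw [multinomialPMF, if_pos (by omega), hlast, multinomialWeight, ← hspec,
    Fin.prod_univ_castSucc, Fin.prod_univ_castSucc]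
  simp only [extP, Fin.snoc_castSucc, Fin.snoc_last, Fin.init]
  push_cast
  have h1 : (∏ i : Fin d, ((κ i.castSucc).factorial : ℝ)) ≠ 0 :=
    Finset.prod_ne_zero_iff.2 fun i _ => by positivity
  have h2 : ((κ (Fin.last d)).factorial : ℝ) ≠ 0 := by positivity
  rw [mul_div_cancel_left₀ _ (mul_ne_zero h1 h2)]

lemma injOn_init (d n : ℕ) :
    Set.InjOn (fun κ : Fin (d + 1) → ℕ => (Fin.init κ : Fin d → ℕ))
      (piAntidiag univ n : Finset (Fin (d + 1) → ℕ)) := by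
  intro κ hκ κ' hκ' h
  have h1 : ∑ i, κ i = n := (mem_piAntidiag.1 hκ).1
  have h2 : ∑ i, κ' i = n := (mem_piAntidiag.1 hκ').1
  rw [Fin.sum_univ_castSucc] at h1 h2
  have h3 : ∀ i : Fin d, κ i.castSucc = κ' i.castSucc := fun i => congrFun h i
  funext i
  refine Fin.lastCases ?_ h3 i
  simp only [h3] at h1
  omega

/-- The multinomial law as a finite sum of Dirac masses in symmetric coordinates. -/
lemma multinomialLaw_eq_sum (d n : ℕ) (p : Fin d → ℝ) :
    multinomialLaw d n p = ∑ κ ∈ piAntidiag univ n,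
      ENNReal.ofReal (multinomialWeight (extP d p) κ) •
        Measure.dirac (castK d (Fin.init κ : Fin d → ℕ)) := by
  ext s hs
  rw [multinomialLaw, Measure.sum_apply _ hs,
    tsum_eq_sum (s := (piAntidiag univ n).image
      (fun κ : Fin (d + 1) → ℕ => (Fin.init κ : Fin d → ℕ))),
    Finset.sum_image (injOn_init d n), Measure.finsetSum_apply]
  · exact Finset.sum_congr rfl fun κ hκ => by rw [multinomialPMF_init p hκ]
  · intro k hk
    have : ¬ ∑ i, k i ≤ n := by
      intro hle
      refine hk (Finset.mem_image.2 ⟨Fin.snoc k (n - ∑ i, k i), ?_, Fin.init_snoc _ _⟩)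
      refine mem_piAntidiag.2 ⟨?_, fun _ _ => Finset.mem_univ _⟩
      simp only [Fin.sum_univ_castSucc, Fin.snoc_castSucc, Fin.snoc_last]
      omega
    simp [multinomialPMF, this]

/-- The candidate for the inverse covariance matrix. -/
def precM (d : ℕ) (p : Fin d → ℝ) : Matrix (Fin d) (Fin d) ℝ :=
  Matrix.diagonal (fun i => (p i)⁻¹) + (1 - ∑ i, p i)⁻¹ • Matrix.vecMulVec 1 1

lemma covM_mul_precM {d : ℕ} {p : Fin d → ℝ} (hp : p ∈ simplexInt d) :
    covM d p * precM d p = 1 := by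
  have hl : (1 - ∑ i, p i) ≠ 0 := by linarith [hp.2]
  ext i j
  have hi : p i ≠ 0 := (hp.1 i).1.ne'
  have hj : p j ≠ 0 := (hp.1 j).1.ne'
  simp only [covM, precM, Matrix.mul_apply, Matrix.sub_apply, Matrix.add_apply,
    Matrix.diagonal_apply, Matrix.vecMulVec_apply, Matrix.smul_apply, Pi.one_apply, mul_one,
    smul_eq_mul, sub_mul, mul_add, Finset.sum_sub_distrib, Finset.sum_add_distrib, mul_ite,
    ite_mul, zero_mul, mul_zero, Finset.sum_ite_eq, Finset.sum_ite_eq', Finset.mem_univ, if_true,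
    ← Finset.sum_mul, ← Finset.mul_sum, Matrix.one_apply, mul_assoc, mul_inv_cancel₀ hj]
  by_cases hij : i = j
  · subst hij
    simp only [if_true, mul_inv_cancel₀ hi]
    field_simp
    ring
  · simp only [hij, if_false]
    field_simp
    ring

lemma inv_covM {d : ℕ} {p : Fin d → ℝ} (hp : p ∈ simplexInt d) : (covM d p)⁻¹ = precM d p :=
  Matrix.inv_eq_right_inv (covM_mul_precM hp)

lemma det_covM (d : ℕ) (p : Fin d → ℝ) :
    (covM d p).det = ∏ i, extP d p i := by
  have e : covM d p = Matrix.diagonal p *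
      (1 + Matrix.replicateCol Unit (-1 : Fin d → ℝ) * Matrix.replicateRow Unit p) := by
    ext i j
    rw [Matrix.diagonal_mul]
    simp [covM, Matrix.mul_apply, Matrix.vecMulVec_apply, Matrix.one_apply,
      Matrix.diagonal_apply, mul_add, sub_eq_add_neg]
  rw [e, Matrix.det_mul, Matrix.det_diagonal, Matrix.det_one_add_replicateCol_mul_replicateRow,
    Fin.prod_univ_castSucc]
  simp [extP, dotProduct, sub_eq_add_neg]

lemma det_precM {d : ℕ} {p : Fin d → ℝ} (hp : p ∈ simplexInt d) :
    (precM d p).det = (∏ i, extP d p i)⁻¹ := by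
  have h := congrArg Matrix.det (covM_mul_precM hp)
  rw [Matrix.det_mul, Matrix.det_one, det_covM] at h
  exact eq_inv_of_mul_eq_one_right h

open scoped MatrixOrder in
lemma exists_transpose_mul_self_eq_precM {d : ℕ} {p : Fin d → ℝ} (hp : p ∈ simplexInt d) :
    ∃ B : Matrix (Fin d) (Fin d) ℝ, Bᵀ * B = precM d p := by
  have h1 : (Matrix.diagonal (fun i => (p i)⁻¹)).PosSemidef :=
    Matrix.PosSemidef.diagonal fun i => inv_nonneg.2 (hp.1 i).1.le
  have h2 : (Matrix.vecMulVec (1 : Fin d → ℝ) 1).PosSemidef := by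
    simpa using Matrix.posSemidef_vecMulVec_self_star (1 : Fin d → ℝ)
  have h3 : (precM d p).PosSemidef :=
    h1.add (h2.smul (inv_nonneg.2 (by linarith [hp.2] : (0 : ℝ) ≤ 1 - ∑ i, p i)))
  obtain ⟨B, hB⟩ := CStarAlgebra.nonneg_iff_eq_star_mul_self.mp h3.nonneg
  exact ⟨B, by rw [hB, Matrix.star_eq_conjTranspose, Matrix.conjTranspose_eq_transpose_of_trivial]⟩

lemma quadForm_delVec {d n : ℕ} (hn : n ≠ 0) {p : Fin d → ℝ} (hp : p ∈ simplexInt d)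
    (y : Fin d → ℝ) :
    quadForm d p (delVec d n p y)
      = ∑ i, (extV d n y i - n * extP d p i) ^ 2 / (n * extP d p i) := by
  have hn0 : (0 : ℝ) < n := by positivity
  have hl : (1 - ∑ i, p i) ≠ 0 := by linarith [hp.2]
  have hsq : √(n : ℝ) ^ 2 = n := Real.sq_sqrt hn0.le
  have hsq0 : √(n : ℝ) ≠ 0 := by positivity
  have hdel : ∑ i, delVec d n p y i = (∑ i, y i - n * ∑ i, p i) / √n := by
    simp only [delVec, del]
    rw [← Finset.sum_div, Finset.sum_sub_distrib, Finset.mul_sum]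
  have hq : quadForm d p (delVec d n p y)
      = ∑ i, delVec d n p y i ^ 2 / p i + (∑ i, delVec d n p y i) ^ 2 / (1 - ∑ i, p i) := by
    rw [quadForm, inv_covM hp, precM, Matrix.add_mulVec, dotProduct_add, Matrix.smul_mulVec,
      dotProduct_smul]
    congr 1
    · simp only [dotProduct, Matrix.mulVec_diagonal]
      exact Finset.sum_congr rfl fun i _ => by ring
    · simp only [dotProduct, Matrix.mulVec, Matrix.vecMulVec_apply, Pi.one_apply, one_mul,
        smul_eq_mul, ← Finset.sum_mul]
      ring
  rw [hq, hdel, Fin.sum_univ_castSucc]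
  simp only [extV, extP, Fin.snoc_castSucc, Fin.snoc_last, delVec, del]
  congr 1
  · refine Finset.sum_congr rfl fun i _ => ?_
    rw [div_pow, hsq, div_div]
  · rw [div_pow, hsq, div_div]
    congr 1
    ring

/-- The density of the normal law with the mean and covariance of the multinomial law. -/
def normalDensity (d n : ℕ) (p y : Fin d → ℝ) : ℝ :=
  (n : ℝ) ^ (-(d : ℝ) / 2) * gaussDens d p (delVec d n p y)

lemma normalDensity_pos {d n : ℕ} (hn : n ≠ 0) {p : Fin d → ℝ} (hp : p ∈ simplexInt d)
    (y : Fin d → ℝ) : 0 < normalDensity d n p y := by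
  have : 0 < ∏ i, extP d p i := Finset.prod_pos fun i _ => extP_pos hp i
  unfold normalDensity gaussDens
  positivity

lemma log_normalDensity {d n : ℕ} (hn : n ≠ 0) {p : Fin d → ℝ} (hp : p ∈ simplexInt d)
    (y : Fin d → ℝ) :
    log (normalDensity d n p y) = -((d : ℝ) / 2 * (log n + log (2 * π)))
      - (∑ i, log (extP d p i)) / 2
      - (∑ i, (extV d n y i - n * extP d p i) ^ 2 / (n * extP d p i)) / 2 := by
  have hn0 : (0 : ℝ) < n := by positivity
  have hP : 0 < ∏ i, extP d p i := Finset.prod_pos fun i _ => extP_pos hp i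
  have h2π : (0 : ℝ) < (2 * π) ^ d := by positivity
  rw [normalDensity, gaussDens, log_mul (by positivity) (by positivity), log_rpow hn0,
    log_div (by positivity) (by positivity), log_exp, log_sqrt (by positivity),
    log_mul h2π.ne' hP.ne', log_pow, log_prod fun i _ => (extP_pos hp i).ne',
    quadForm_delVec hn hp]
  ring

lemma continuous_normalDensity {d n : ℕ} (p : Fin d → ℝ) : Continuous (normalDensity d n p) := by
  unfold normalDensity gaussDens quadForm delVec del
  refine continuous_const.mul (Continuous.div_const ?_ _)
  fun_prop

lemma lintegral_exp_neg_sum_sq (d : ℕ) :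
    ∫⁻ z : Fin d → ℝ, ENNReal.ofReal (rexp (-(1 / 2) * ∑ i, z i ^ 2))
      = ENNReal.ofReal (√(2 * π) ^ d) := by
  have e : (fun z : Fin d → ℝ => rexp (-(1 / 2) * ∑ i, z i ^ 2))
      = fun z => ∏ i, rexp (-(1 / 2) * z i ^ 2) := by
    funext z
    rw [← Real.exp_sum, Finset.mul_sum]
  have hint : Integrable (fun z : Fin d → ℝ => ∏ i, rexp (-(1 / 2) * z i ^ 2)) :=
    Integrable.fintype_prod (f := fun _ x => rexp (-(1 / 2) * x ^ 2))
      fun _ => integrable_exp_neg_mul_sq (by norm_num)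
  have hv : ∫ z : Fin d → ℝ, ∏ i, rexp (-(1 / 2) * z i ^ 2) = √(2 * π) ^ d := by
    rw [integral_fintype_prod_volume_eq_pow (fun x : ℝ => rexp (-(1 / 2) * x ^ 2)),
      integral_gaussian, Fintype.card_fin]
    congr 2
    ring
  rw [← hv, ofReal_integral_eq_lintegral_ofReal hint
    (Filter.Eventually.of_forall fun z => Finset.prod_nonneg fun i _ => (exp_pos _).le)]
  exact lintegral_congr fun z => by rw [congrFun e z]

lemma lintegral_normalDensity {d n : ℕ} (hn : n ≠ 0) {p : Fin d → ℝ} (hp : p ∈ simplexInt d) :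
    ∫⁻ y, ENNReal.ofReal (normalDensity d n p y) = 1 := by
  have hn0 : (0 : ℝ) < n := by positivity
  have hP : 0 < ∏ i, extP d p i := Finset.prod_pos fun i _ => extP_pos hp i
  obtain ⟨B, hB⟩ := exists_transpose_mul_self_eq_precM hp
  have hdet : B.det ^ 2 = (∏ i, extP d p i)⁻¹ := by
    rw [← det_precM hp, ← hB, Matrix.det_mul, Matrix.det_transpose, sq]
  set A : Matrix (Fin d) (Fin d) ℝ := (√n)⁻¹ • B with hA
  have hdetA : A.det = (√n)⁻¹ ^ d * B.det := by
    rw [hA, Matrix.det_smul, Fintype.card_fin]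
  have hBabs : |B.det| = (√(∏ i, extP d p i))⁻¹ := by
    rw [← Real.sqrt_sq_eq_abs, hdet, Real.sqrt_inv]
  have hB0 : B.det ≠ 0 := by
    rw [← abs_pos, hBabs]
    positivity
  have hA0 : A.det ≠ 0 := by
    rw [hdetA]
    positivity
  set c : ℝ := (n : ℝ) ^ (-(d : ℝ) / 2) / √((2 * π) ^ d * ∏ i, extP d p i) with hc
  have hc0 : 0 ≤ c := by positivity
  have hq : ∀ y, normalDensity d n p y
      = c * rexp (-(1 / 2) * ∑ i, (Matrix.toLin' A (y - fun i => n * p i)) i ^ 2) := by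
    intro y
    have e : quadForm d p (delVec d n p y)
        = ∑ i, (Matrix.toLin' A (y - fun i => n * p i)) i ^ 2 := by
      have e1 : Matrix.toLin' A (y - fun i => n * p i) = B *ᵥ (delVec d n p y) := by
        rw [Matrix.toLin'_apply, hA, Matrix.smul_mulVec, ← Matrix.mulVec_smul]
        congr 1
        funext i
        simp only [delVec, del, Pi.smul_apply, Pi.sub_apply, smul_eq_mul]
        ring
      rw [e1, quadForm, inv_covM hp, ← hB, ← Matrix.mulVec_mulVec, Matrix.dotProduct_mulVec,
        Matrix.vecMul_transpose]
      simp only [dotProduct, sq]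
    rw [normalDensity, gaussDens, e, hc]
    ring
  simp only [hq, ENNReal.ofReal_mul hc0]
  rw [lintegral_sub_right_eq_self (fun y => ENNReal.ofReal c *
      ENNReal.ofReal (rexp (-(1 / 2) * ∑ i, (Matrix.toLin' A y) i ^ 2)))]
  rw [lintegral_const_mul' _ _ ENNReal.ofReal_ne_top]
  have hmeas : Measurable fun z : Fin d → ℝ =>
      ENNReal.ofReal (rexp (-(1 / 2) * ∑ i, z i ^ 2)) := by fun_prop
  have hmA : Measurable (Matrix.toLin' A) :=
    (LinearMap.continuous_of_finiteDimensional (Matrix.toLin' A)).measurable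
  rw [← lintegral_map hmeas hmA, Real.map_matrix_volume_pi_eq_smul_volume_pi hA0,
    lintegral_smul_measure, lintegral_exp_neg_sum_sq, smul_eq_mul,
    ← ENNReal.ofReal_mul (abs_nonneg _), ← ENNReal.ofReal_mul hc0, ← ENNReal.ofReal_one]
  congr 1
  have hnd : (n : ℝ) ^ (-(d : ℝ) / 2) = (√n ^ d)⁻¹ := by
    rw [neg_div, rpow_neg hn0.le, Real.sqrt_eq_rpow, ← rpow_natCast, ← rpow_mul hn0.le]
    congr 2
    ring
  have hs : √((2 * π) ^ d * ∏ i, extP d p i) = √(2 * π) ^ d * √(∏ i, extP d p i) := by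
    rw [Real.sqrt_mul (by positivity)]
    congr 1
    rw [Real.sqrt_eq_iff_mul_self_eq (by positivity) (by positivity), ← mul_pow,
      Real.mul_self_sqrt (by positivity)]
  rw [hc, hnd, hs, abs_inv, hdetA, inv_pow, abs_mul, hBabs, abs_of_pos (by positivity)]
  have h1 : √(n : ℝ) ≠ 0 := by positivity
  have h2 : √(2 * π) ≠ 0 := by positivity
  have h3 : √(∏ i, extP d p i) ≠ 0 := by positivity
  field_simp

/-- If `μ B - ν B ≤ ε` for all measurable `B`, the total variation norm of `μ - ν` is at
most `2ε`, provided `ν` has no more mass than `μ`. -/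
lemma totalVariation_sub_le {α : Type*} [MeasurableSpace α] (μ ν : Measure α) [IsFiniteMeasure μ]
    [IsFiniteMeasure ν] (hle : ν.real Set.univ ≤ μ.real Set.univ) {ε : ℝ}
    (h : ∀ B, MeasurableSet B → μ.real B - ν.real B ≤ ε) :
    (μ.toSignedMeasure - ν.toSignedMeasure).totalVariation Set.univ ≤ ENNReal.ofReal (2 * ε) := by
  set s := μ.toSignedMeasure - ν.toSignedMeasure with hs
  obtain ⟨i, hi, h0, h1, hpos, hneg⟩ := s.toJordanDecomposition_spec
  have e1 : s.toJordanDecomposition.posPart.real Set.univ = μ.real i - ν.real i := by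
    rw [hpos, SignedMeasure.toMeasureOfZeroLE_real_apply _ h0 hi MeasurableSet.univ,
      Set.inter_univ, hs, Measure.toSignedMeasure_sub_apply hi]
  have e2 : s.toJordanDecomposition.negPart.real Set.univ = -(μ.real iᶜ - ν.real iᶜ) := by
    rw [hneg, SignedMeasure.toMeasureOfLEZero_real_apply _ h1 hi.compl MeasurableSet.univ,
      Set.inter_univ, hs, Measure.toSignedMeasure_sub_apply hi.compl]
  have e3 : s.totalVariation.real Set.univ
      = (μ.real i - ν.real i) + -(μ.real iᶜ - ν.real iᶜ) := by
    rw [SignedMeasure.totalVariation, measureReal_add_apply, e1, e2]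
  have e4 := h i hi
  rw [measureReal_compl hi, measureReal_compl hi] at e3
  have : IsFiniteMeasure s.totalVariation := by
    unfold SignedMeasure.totalVariation
    infer_instance
  rw [← ofReal_measureReal]
  exact ENNReal.ofReal_le_ofReal (by linarith)

instance isProbabilityMeasure_uniformBoxLaw (d : ℕ) :
    IsProbabilityMeasure (uniformBoxLaw d) := by
  constructor
  rw [uniformBoxLaw, Measure.restrict_apply_univ, Real.volume_pi_Ioo]
  norm_num

lemma integrable_uniformBoxLaw {d : ℕ} {f : (Fin d → ℝ) → ℝ} (hf : Continuous f) :
    Integrable f (uniformBoxLaw d) := by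
  have h : IsCompact (Set.univ.pi fun _ : Fin d => Set.Icc (-(1 : ℝ) / 2) (1 / 2)) :=
    isCompact_univ_pi fun _ => isCompact_Icc
  exact (hf.continuousOn.integrableOn_compact h).mono_set
    (Set.pi_mono fun _ _ => Set.Ioo_subset_Icc_self)

lemma ae_abs_le_uniformBoxLaw (d : ℕ) :
    ∀ᵐ u ∂uniformBoxLaw d, ∀ i, |u i| ≤ 1 / 2 := by
  refine (ae_restrict_mem (MeasurableSet.univ_pi fun _ => measurableSet_Ioo)).mono fun u hu i => ?_
  have := hu i (Set.mem_univ i)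
  rw [abs_le]
  constructor <;> linarith [this.1, this.2]

/-- Translates of the unit box by distinct integer vectors are disjoint, so the sum of the
integrals over them is at most the full integral. -/
lemma sum_integral_box_le {d : ℕ} {ι : Type*} (s : Finset ι) (k : ι → Fin d → ℕ)
    (hk : Set.InjOn k s) {g : (Fin d → ℝ) → ℝ} (hg : Integrable g) (hg0 : ∀ y, 0 ≤ g y) :
    ∑ κ ∈ s, ∫ u, g (castK d (k κ) + u) ∂uniformBoxLaw d ≤ ∫ y, g y := by
  set S : ι → Set (Fin d → ℝ) := fun κ =>
    (fun y => -castK d (k κ) + y) ⁻¹'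
      (Set.univ.pi fun _ : Fin d => Set.Ioo (-(1 : ℝ) / 2) (1 / 2)) with hS
  have hbox : MeasurableSet (Set.univ.pi fun _ : Fin d => Set.Ioo (-(1 : ℝ) / 2) (1 / 2)) :=
    MeasurableSet.univ_pi fun _ => measurableSet_Ioo
  have hSm : ∀ κ, MeasurableSet (S κ) := fun κ => hbox.preimage (by fun_prop)
  have h1 : ∀ κ, ∫ u, g (castK d (k κ) + u) ∂uniformBoxLaw d = ∫ y in S κ, g y := by
    intro κ
    rw [uniformBoxLaw, ← integral_indicator hbox, ← integral_indicator (hSm κ),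
      ← integral_add_left_eq_self ((S κ).indicator g) (castK d (k κ))]
    congr 1
    funext u
    have hmem : castK d (k κ) + u ∈ S κ
        ↔ u ∈ Set.univ.pi fun _ : Fin d => Set.Ioo (-(1 : ℝ) / 2) (1 / 2) := by
      rw [hS, Set.mem_preimage, neg_add_cancel_left]
    by_cases hu : u ∈ Set.univ.pi fun _ : Fin d => Set.Ioo (-(1 : ℝ) / 2) (1 / 2)
    · rw [Set.indicator_of_mem hu, Set.indicator_of_mem (hmem.2 hu)]
    · rw [Set.indicator_of_notMem hu, Set.indicator_of_notMem (mt hmem.1 hu)]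
  simp only [h1]
  rw [← integral_biUnion_finset s (fun κ _ => hSm κ) ?_ fun κ _ => hg.integrableOn]
  · exact setIntegral_le_integral hg (Filter.Eventually.of_forall hg0)
  · intro κ hκ κ' hκ' hne
    refine Set.disjoint_left.2 fun y hy hy' => hne (hk hκ hκ' ?_)
    funext i
    have a1 := hy i (Set.mem_univ i)
    have a2 := hy' i (Set.mem_univ i)
    simp only [Pi.add_apply, Pi.neg_apply, castK, Set.mem_Ioo] at a1 a2
    have b1 : ((k κ i : ℕ) : ℝ) < (k κ' i : ℝ) + 1 := by linarith [a1.1, a2.2, a1.2, a2.1]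
    have b2 : ((k κ' i : ℕ) : ℝ) < (k κ i : ℝ) + 1 := by linarith [a1.1, a2.2, a1.2, a2.1]
    have b1' : k κ i < k κ' i + 1 := by exact_mod_cast b1
    have b2' : k κ' i < k κ i + 1 := by exact_mod_cast b2
    omega

/-- Bound for the mean negative log-density over a translated unit box. -/
lemma neg_integral_log_normalDensity_le {d n : ℕ} (hn : n ≠ 0) {p : Fin d → ℝ}
    (hp : p ∈ simplexInt d) : ∃ c : Fin (d + 1) → ℝ, ∀ κ ∈ piAntidiag univ n,
    -∫ u, log (normalDensity d n p (castK d (Fin.init κ : Fin d → ℕ) + u)) ∂uniformBoxLaw d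
      ≤ (d : ℝ) / 2 * (log n + log (2 * π)) + (∑ i, log (extP d p i)) / 2
        + (∑ i, (((κ i : ℝ) - n * extP d p i) ^ 2 + c i * ((κ i : ℝ) - n * extP d p i)
          + ((d : ℝ) + 1) ^ 2 / 4) / (n * extP d p i)) / 2 := by
  have hn0 : (0 : ℝ) < n := by positivity
  let v : Fin (d + 1) → (Fin d → ℝ) → ℝ := fun i u =>
    (Fin.snoc u (-∑ j, u j) : Fin (d + 1) → ℝ) i
  have hvc : ∀ i, Continuous (v i) := by
    intro i
    refine Fin.lastCases ?_ (fun i => ?_) i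
    · simp only [v, Fin.snoc_last]
      fun_prop
    · simp only [v, Fin.snoc_castSucc]
      fun_prop
  have hvb : ∀ᵐ u ∂uniformBoxLaw d, ∀ i, v i u ^ 2 ≤ ((d : ℝ) + 1) ^ 2 / 4 := by
    refine (ae_abs_le_uniformBoxLaw d).mono fun u hu i => ?_
    have : |v i u| ≤ ((d : ℝ) + 1) / 2 := by
      refine Fin.lastCases ?_ (fun i => ?_) i
      · simp only [v, Fin.snoc_last, abs_neg]
        refine (Finset.abs_sum_le_sum_abs _ _).trans
          ((Finset.sum_le_sum fun i _ => hu i).trans ?_)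
        simp only [Finset.sum_const, Finset.card_univ, Fintype.card_fin, nsmul_eq_mul]
        linarith
      · simp only [v, Fin.snoc_castSucc]
        refine (hu i).trans ?_
        have : (0 : ℝ) ≤ d := Nat.cast_nonneg d
        linarith
    have h2 := pow_le_pow_left₀ (abs_nonneg _) this 2
    rw [sq_abs] at h2
    linarith
  refine ⟨fun i => ∫ u, 2 * v i u ∂uniformBoxLaw d, fun κ hκ => ?_⟩
  have hsum : ∑ i, κ i = n := (mem_piAntidiag.1 hκ).1
  have hext : ∀ u i, extV d n (castK d (Fin.init κ : Fin d → ℕ) + u) i = κ i + v i u := by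
    intro u i
    refine Fin.lastCases ?_ (fun i => ?_) i
    · rw [← hsum, Fin.sum_univ_castSucc]
      simp only [extV, v, Fin.snoc_last, castK, Fin.init, Pi.add_apply, Finset.sum_add_distrib]
      push_cast
      ring
    · simp [extV, v, castK, Fin.init]
  have hlog : ∀ u, -log (normalDensity d n p (castK d (Fin.init κ : Fin d → ℕ) + u))
      = (d : ℝ) / 2 * (log n + log (2 * π)) + (∑ i, log (extP d p i)) / 2
        + (∑ i, (((κ i : ℝ) - n * extP d p i) ^ 2 + 2 * v i u * ((κ i : ℝ) - n * extP d p i)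
          + v i u ^ 2) / (n * extP d p i)) / 2 := by
    intro u
    rw [log_normalDensity hn hp]
    simp only [hext]
    have : ∀ i, ((κ i : ℝ) + v i u - n * extP d p i) ^ 2
        = ((κ i : ℝ) - n * extP d p i) ^ 2 + 2 * v i u * ((κ i : ℝ) - n * extP d p i)
          + v i u ^ 2 := fun i => by ring
    simp only [this]
    ring
  rw [← integral_neg]
  have hI : ∫ u, ((d : ℝ) / 2 * (log n + log (2 * π)) + (∑ i, log (extP d p i)) / 2
        + (∑ i, (((κ i : ℝ) - n * extP d p i) ^ 2 + 2 * v i u * ((κ i : ℝ) - n * extP d p i)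
          + ((d : ℝ) + 1) ^ 2 / 4) / (n * extP d p i)) / 2) ∂uniformBoxLaw d
      = (d : ℝ) / 2 * (log n + log (2 * π)) + (∑ i, log (extP d p i)) / 2
        + (∑ i, (((κ i : ℝ) - n * extP d p i) ^ 2
          + (∫ u, 2 * v i u ∂uniformBoxLaw d) * ((κ i : ℝ) - n * extP d p i)
          + ((d : ℝ) + 1) ^ 2 / 4) / (n * extP d p i)) / 2 := by
    have hi1 : ∀ i, Integrable (fun u => 2 * v i u * ((κ i : ℝ) - n * extP d p i))
        (uniformBoxLaw d) := fun i => integrable_uniformBoxLaw (by have := hvc i; fun_prop)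
    have hi2 : ∀ i, Integrable (fun u => (((κ i : ℝ) - n * extP d p i) ^ 2
        + 2 * v i u * ((κ i : ℝ) - n * extP d p i)
          + ((d : ℝ) + 1) ^ 2 / 4) / (n * extP d p i)) (uniformBoxLaw d) := fun i =>
      integrable_uniformBoxLaw (by have := hvc i; fun_prop)
    rw [integral_add (integrable_const _) ((integrable_finsetSum _ fun i _ => hi2 i).div_const 2),
      integral_const, integral_div, integral_finsetSum _ fun i _ => hi2 i]
    simp only [probReal_univ, one_smul]
    congr 2
    refine Finset.sum_congr rfl fun i _ => ?_
    have hi3 : Integrable (fun u => ((κ i : ℝ) - n * extP d p i) ^ 2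
        + 2 * v i u * ((κ i : ℝ) - n * extP d p i)) (uniformBoxLaw d) :=
      integrable_uniformBoxLaw (by have := hvc i; fun_prop)
    rw [integral_div, integral_add hi3 (integrable_const _),
      integral_add (integrable_const _) (hi1 i), integral_mul_const, integral_const,
      integral_const]
    simp only [probReal_univ, one_smul]
  rw [← hI]
  refine integral_mono_ae ?_ ?_ ?_
  · refine Integrable.congr (integrable_uniformBoxLaw (f := fun u =>
      (d : ℝ) / 2 * (log n + log (2 * π)) + (∑ i, log (extP d p i)) / 2
        + (∑ i, (((κ i : ℝ) - n * extP d p i) ^ 2 + 2 * v i u * ((κ i : ℝ) - n * extP d p i)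
          + v i u ^ 2) / (n * extP d p i)) / 2) (by fun_prop)) ?_
    exact Filter.Eventually.of_forall fun u => (hlog u).symm
  · exact integrable_uniformBoxLaw (by fun_prop)
  · refine hvb.mono fun u hu => ?_
    simp only [hlog]
    have : ∀ i, 0 ≤ n * extP d p i := fun i => (mul_pos hn0 (extP_pos hp i)).le
    gcongr with i _
    · exact this i
    · exact hu i

/-- Bound for the Kullback-Leibler divergence between the jittered multinomial law and its
Gaussian approximation. -/
lemma sum_multinomialWeight_mul_log_sub_le {d n : ℕ} (hn : n ≠ 0) {p : Fin d → ℝ}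
    (hp : p ∈ simplexInt d) {τ : ℝ} (hτ : (d : ℝ) + 1 ≤ τ) (hpτ : ∀ i, (extP d p i)⁻¹ ≤ τ) :
    ∑ κ ∈ piAntidiag univ n, (multinomialWeight (extP d p) κ
        * log (multinomialWeight (extP d p) κ)
      - multinomialWeight (extP d p) κ * ∫ u, log (normalDensity d n p
        (castK d (Fin.init κ : Fin d → ℕ) + u)) ∂uniformBoxLaw d) ≤ (d + 1) * τ ^ 3 / n := by
  obtain ⟨c, hc⟩ := neg_integral_log_normalDensity_le hn hp
  have hn0 : (0 : ℝ) < n := by positivity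
  have hP := extP_pos hp
  have hS := extP_sum d p
  have hW := sum_multinomialWeight n hS 0
  have h1 := sum_multinomialWeight_mul_log_le hn hP hS
  have hcross : ∑ κ ∈ piAntidiag univ n, multinomialWeight (extP d p) κ *
      ((d : ℝ) / 2 * (log n + log (2 * π)) + (∑ i, log (extP d p i)) / 2
        + (∑ i, (((κ i : ℝ) - n * extP d p i) ^ 2 + c i * ((κ i : ℝ) - n * extP d p i)
          + ((d : ℝ) + 1) ^ 2 / 4) / (n * extP d p i)) / 2)
      = (d : ℝ) / 2 * (log n + log (2 * π)) + (∑ i, log (extP d p i)) / 2 + (d : ℝ) / 2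
        + ∑ i, ((d : ℝ) + 1) ^ 2 / (8 * (n * extP d p i)) := by
    have hi : ∀ i, ∑ κ ∈ piAntidiag univ n, multinomialWeight (extP d p) κ *
        ((((κ i : ℝ) - n * extP d p i) ^ 2 + c i * ((κ i : ℝ) - n * extP d p i)
          + ((d : ℝ) + 1) ^ 2 / 4) / (n * extP d p i))
        = (1 - extP d p i) + 2 * (((d : ℝ) + 1) ^ 2 / (8 * (n * extP d p i))) := by
      intro i
      have hne := (hP i).ne'
      calc _ = ((∑ κ ∈ piAntidiag univ n, multinomialWeight (extP d p) κ *
              ((κ i : ℝ) - n * extP d p i) ^ 2)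
            + c i * (∑ κ ∈ piAntidiag univ n, multinomialWeight (extP d p) κ *
              ((κ i : ℝ) - n * extP d p i))
            + ((d : ℝ) + 1) ^ 2 / 4 * ∑ κ ∈ piAntidiag univ n, multinomialWeight (extP d p) κ)
              / (n * extP d p i) := by
            rw [Finset.mul_sum, Finset.mul_sum, ← Finset.sum_add_distrib,
              ← Finset.sum_add_distrib, Finset.sum_div]
            exact Finset.sum_congr rfl fun κ _ => by ring
        _ = _ := by
            rw [sum_multinomialWeight_centered_sq n hS, sum_multinomialWeight_centered n hS, hW]
            field_simp
            ring
    have hsplit : ∀ (a : ℝ) (x : (Fin (d + 1) → ℕ) → ℝ),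
        ∑ κ ∈ piAntidiag univ n, multinomialWeight (extP d p) κ * (a + x κ)
          = a + ∑ κ ∈ piAntidiag univ n, multinomialWeight (extP d p) κ * x κ := fun a x => by
      simp only [mul_add, Finset.sum_add_distrib, ← Finset.sum_mul, hW, one_mul]
    rw [hsplit]
    have : ∑ κ ∈ piAntidiag univ n, multinomialWeight (extP d p) κ *
        ((∑ i, (((κ i : ℝ) - n * extP d p i) ^ 2 + c i * ((κ i : ℝ) - n * extP d p i)
          + ((d : ℝ) + 1) ^ 2 / 4) / (n * extP d p i)) / 2)
        = (∑ i, ((1 - extP d p i) + 2 * (((d : ℝ) + 1) ^ 2 / (8 * (n * extP d p i))))) / 2 := by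
      simp only [← hi]
      rw [Finset.sum_comm, Finset.sum_div]
      refine Finset.sum_congr rfl fun κ _ => ?_
      rw [← Finset.mul_sum, mul_div_assoc]
    rw [this, Finset.sum_add_distrib, Finset.sum_sub_distrib, hS, ← Finset.mul_sum]
    simp only [Finset.sum_const, Finset.card_univ, Fintype.card_fin, nsmul_eq_mul]
    push_cast
    ring
  have h2 := (Finset.sum_le_sum fun κ (hκ : κ ∈ piAntidiag univ n) =>
    mul_le_mul_of_nonneg_left (hc κ hκ) (multinomialWeight_pos hP κ).le).trans_eq hcross
  have hinv : ∀ i, 1 / (n * extP d p i) ≤ τ / n := fun i => by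
    rw [one_div, mul_inv, mul_comm, div_eq_mul_inv]
    exact mul_le_mul_of_nonneg_right (hpτ i) (by positivity)
  have hd : (0 : ℝ) ≤ d := Nat.cast_nonneg d
  have h3 : ∑ i, 2 / (3 * (n * extP d p i)) ≤ ((d : ℝ) + 1) * (2 / 3 * (τ / n)) := by
    refine (Finset.sum_le_sum fun i _ => (?_ : _ ≤ 2 / 3 * (τ / n))).trans_eq ?_
    · calc 2 / (3 * (n * extP d p i)) = 2 / 3 * (1 / (n * extP d p i)) := by ring
        _ ≤ _ := by have := hinv i; gcongr
    · simp
  have h4 : ∑ i, ((d : ℝ) + 1) ^ 2 / (8 * (n * extP d p i))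
      ≤ ((d : ℝ) + 1) * (((d : ℝ) + 1) ^ 2 / 8 * (τ / n)) := by
    refine (Finset.sum_le_sum fun i _ =>
      (?_ : _ ≤ ((d : ℝ) + 1) ^ 2 / 8 * (τ / n))).trans_eq ?_
    · calc ((d : ℝ) + 1) ^ 2 / (8 * (n * extP d p i))
          = ((d : ℝ) + 1) ^ 2 / 8 * (1 / (n * extP d p i)) := by ring
        _ ≤ _ := by have := hinv i; gcongr
    · simp
  have h5 : 1 / (12 * (n : ℝ)) + ((d : ℝ) + 1) * (2 / 3 * (τ / n))
      + ((d : ℝ) + 1) * (((d : ℝ) + 1) ^ 2 / 8 * (τ / n)) ≤ (d + 1) * τ ^ 3 / n := by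
    have hτ1 : 1 ≤ τ := by linarith
    have e1 : ((d : ℝ) + 1) ^ 2 ≤ τ ^ 2 := by gcongr
    have e2 : τ ≤ τ ^ 3 := le_self_pow₀ hτ1 (by norm_num)
    have e3 : ((d : ℝ) + 1) ^ 2 * τ ≤ τ ^ 3 := by
      calc ((d : ℝ) + 1) ^ 2 * τ ≤ τ ^ 2 * τ := by gcongr
        _ = τ ^ 3 := by ring
    have e4 : 1 / 12 + ((d : ℝ) + 1) * (2 / 3 * τ + ((d : ℝ) + 1) ^ 2 * τ / 8)
        ≤ ((d : ℝ) + 1) * τ ^ 3 := by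
      calc _ ≤ ((d : ℝ) + 1) * (1 / 12 * τ ^ 3)
            + ((d : ℝ) + 1) * (2 / 3 * τ ^ 3 + τ ^ 3 / 8) := by
            gcongr
            nlinarith [mul_nonneg hd (by linarith : (0 : ℝ) ≤ τ ^ 3)]
        _ ≤ _ := by nlinarith [mul_nonneg hd (by linarith : (0 : ℝ) ≤ τ ^ 3)]
    calc _ = (1 / 12 + ((d : ℝ) + 1) * (2 / 3 * τ + ((d : ℝ) + 1) ^ 2 * τ / 8)) / n := by ring
      _ ≤ _ := by gcongr
  simp only [mul_neg, Finset.sum_neg_distrib] at h2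
  rw [Fintype.card_fin] at h1
  push_cast at h1
  rw [Finset.sum_sub_distrib]
  linarith

/-- The law of the jittered multinomial vector as a mixture of uniform laws on boxes. -/
lemma map_add_real_apply {d n : ℕ} {p : Fin d → ℝ} (hp : p ∈ simplexInt d)
    {Ω : Type*} [MeasurableSpace Ω] (Pr : Measure Ω) [IsProbabilityMeasure Pr]
    {K U : Ω → Fin d → ℝ} (hKm : Measurable K) (hUm : Measurable U)
    (hK : Measure.map K Pr = multinomialLaw d n p) (hU : Measure.map U Pr = uniformBoxLaw d)
    (hind : ProbabilityTheory.IndepFun K U Pr) {B : Set (Fin d → ℝ)} (hB : MeasurableSet B) :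
    (Measure.map (fun ω => K ω + U ω) Pr).real B
      = ∑ κ ∈ piAntidiag univ n, multinomialWeight (extP d p) κ *
        (uniformBoxLaw d).real ((fun u => castK d (Fin.init κ : Fin d → ℕ) + u) ⁻¹' B) := by
  have hadd : Measurable fun x : (Fin d → ℝ) × (Fin d → ℝ) => x.1 + x.2 := by fun_prop
  have h1 : Measure.map (fun ω => K ω + U ω) Pr
      = Measure.map (fun x : (Fin d → ℝ) × (Fin d → ℝ) => x.1 + x.2)
        ((multinomialLaw d n p).prod (uniformBoxLaw d)) := by
    rw [← hK, ← hU, ← (ProbabilityTheory.indepFun_iff_map_prod_eq_prod_map_map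
      hKm.aemeasurable hUm.aemeasurable).1 hind, Measure.map_map hadd (hKm.prodMk hUm)]
    rfl
  rw [h1, measureReal_def, Measure.map_apply hadd hB, Measure.prod_apply (hadd hB),
    multinomialLaw_eq_sum, lintegral_finsetSum_measure,
    ENNReal.toReal_sum]
  · refine Finset.sum_congr rfl fun κ _ => ?_
    rw [lintegral_smul_measure, lintegral_dirac' _ (measurable_measure_prodMk_left (hadd hB)),
      smul_eq_mul, ENNReal.toReal_mul,
      ENNReal.toReal_ofReal (multinomialWeight_pos (extP_pos hp) κ).le]
    rfl
  · intro κ _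
    rw [lintegral_smul_measure, lintegral_dirac' _ (measurable_measure_prodMk_left (hadd hB))]
    exact ENNReal.mul_ne_top ENNReal.ofReal_ne_top (measure_ne_top _ _)

lemma integrable_normalDensity {d n : ℕ} (hn : n ≠ 0) {p : Fin d → ℝ} (hp : p ∈ simplexInt d) :
    Integrable (normalDensity d n p) := by
  refine ⟨(continuous_normalDensity p).aestronglyMeasurable, ?_⟩
  rw [hasFiniteIntegral_iff_ofReal
    (Filter.Eventually.of_forall fun y => (normalDensity_pos hn hp y).le),
    lintegral_normalDensity hn hp]
  exact ENNReal.one_lt_top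

lemma integral_normalDensity {d n : ℕ} (hn : n ≠ 0) {p : Fin d → ℝ} (hp : p ∈ simplexInt d) :
    ∫ y, normalDensity d n p y = 1 := by
  rw [integral_eq_lintegral_of_nonneg_ae
    (Filter.Eventually.of_forall fun y => (normalDensity_pos hn hp y).le)
    (continuous_normalDensity p).aestronglyMeasurable, lintegral_normalDensity hn hp,
    ENNReal.toReal_one]

lemma gaussLaw_real_apply {d n : ℕ} (hn : n ≠ 0) {p : Fin d → ℝ} (hp : p ∈ simplexInt d)
    {B : Set (Fin d → ℝ)} (hB : MeasurableSet B) :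
    (gaussLaw d n p).real B = ∫ y, B.indicator (normalDensity d n p) y := by
  rw [integral_indicator hB, measureReal_def, gaussLaw, withDensity_apply _ hB,
    integral_eq_lintegral_of_nonneg_ae
    (Filter.Eventually.of_forall fun y => (normalDensity_pos hn hp y).le)
    (continuous_normalDensity p).aestronglyMeasurable]
  rfl

/-- One-sided discrepancy between a box mixture and the Gaussian law, with a free scale `l`. -/
lemma sum_box_sub_gaussLaw_le {d n : ℕ} (hn : n ≠ 0) {p : Fin d → ℝ}
    (hp : p ∈ simplexInt d) {τ : ℝ} (hτ : (d : ℝ) + 1 ≤ τ) (hpτ : ∀ i, (extP d p i)⁻¹ ≤ τ)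
    {l : ℝ} (hl : 0 < l) {B : Set (Fin d → ℝ)} (hB : MeasurableSet B) :
    ∑ κ ∈ piAntidiag univ n, multinomialWeight (extP d p) κ *
        (uniformBoxLaw d).real ((fun u => castK d (Fin.init κ : Fin d → ℕ) + u) ⁻¹' B)
      - (gaussLaw d n p).real B ≤ l / 2 + ((d + 1) * τ ^ 3 / n) / l := by
  set q := normalDensity d n p with hq
  have hqc : Continuous q := continuous_normalDensity p
  have hq0 : ∀ y, 0 < q y := normalDensity_pos hn hp
  have hqi : Integrable q := integrable_normalDensity hn hp
  set w := multinomialWeight (extP d p) with hw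
  have hw0 : ∀ κ, 0 < w κ := multinomialWeight_pos (extP_pos hp)
  have hW : ∑ κ ∈ piAntidiag univ n, w κ = 1 := sum_multinomialWeight n (extP_sum d p) 0
  let e : (Fin (d + 1) → ℕ) → (Fin d → ℝ) → (Fin d → ℝ) := fun κ u =>
    castK d (Fin.init κ : Fin d → ℕ) + u
  have he : ∀ κ, Continuous (e κ) := fun κ => by fun_prop
  have hqe : ∀ κ, Integrable (fun u => q (e κ u)) (uniformBoxLaw d) := fun κ =>
    integrable_uniformBoxLaw (hqc.comp (he κ))
  have hle : ∀ κ, Integrable (fun u => log (q (e κ u))) (uniformBoxLaw d) := fun κ =>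
    integrable_uniformBoxLaw ((hqc.comp (he κ)).log fun u => (hq0 _).ne')
  have hG : ∑ κ ∈ piAntidiag univ n, ∫ u, B.indicator q (e κ u) ∂uniformBoxLaw d
      ≤ (gaussLaw d n p).real B := by
    rw [gaussLaw_real_apply hn hp hB]
    exact sum_integral_box_le _ _ (injOn_init d n) (hqi.indicator hB)
      (Set.indicator_nonneg fun y _ => (hq0 y).le)
  have hT : ∑ κ ∈ piAntidiag univ n, ∫ u, q (e κ u) ∂uniformBoxLaw d ≤ 1 := by
    rw [← integral_normalDensity hn hp]
    exact sum_integral_box_le _ _ (injOn_init d n) hqi fun y => (hq0 y).le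
  have hbox : ∀ κ, w κ * (uniformBoxLaw d).real (e κ ⁻¹' B)
      - ∫ u, B.indicator q (e κ u) ∂uniformBoxLaw d
      ≤ l / 2 * w κ + (w κ * log (w κ) - w κ * (∫ u, log (q (e κ u)) ∂uniformBoxLaw d) - w κ
        + ∫ u, q (e κ u) ∂uniformBoxLaw d) / l := by
    intro κ
    have hBm : MeasurableSet (e κ ⁻¹' B) := (he κ).measurable hB
    have hind : (fun u => B.indicator q (e κ u)) = (e κ ⁻¹' B).indicator (fun u => q (e κ u)) :=
      rfl
    have hi1 : Integrable (fun u => B.indicator q (e κ u)) (uniformBoxLaw d) := by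
      rw [hind]
      exact (hqe κ).indicator hBm
    have hi2 : Integrable ((e κ ⁻¹' B).indicator fun _ => w κ) (uniformBoxLaw d) :=
      (integrable_const _).indicator hBm
    have hi3 : Integrable (fun u => w κ * log (q (e κ u))) (uniformBoxLaw d) :=
      (hle κ).const_mul _
    have hi4 : Integrable (fun u => w κ * log (w κ) - w κ * log (q (e κ u)))
        (uniformBoxLaw d) := (integrable_const _).sub hi3
    have hi5 : Integrable (fun u => w κ * log (w κ) - w κ * log (q (e κ u)) - w κ)
        (uniformBoxLaw d) := hi4.sub (integrable_const _)
    have hi6 : Integrable (fun u => w κ * log (w κ) - w κ * log (q (e κ u)) - w κ + q (e κ u))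
        (uniformBoxLaw d) := hi5.add (hqe κ)
    have hL : w κ * (uniformBoxLaw d).real (e κ ⁻¹' B)
        - ∫ u, B.indicator q (e κ u) ∂uniformBoxLaw d
        = ∫ u, ((e κ ⁻¹' B).indicator (fun _ => w κ) u - B.indicator q (e κ u))
          ∂uniformBoxLaw d := by
      rw [integral_sub hi2 hi1, integral_indicator_const _ hBm, smul_eq_mul, mul_comm]
    have hR : l / 2 * w κ + (w κ * log (w κ) - w κ * (∫ u, log (q (e κ u)) ∂uniformBoxLaw d)
        - w κ + ∫ u, q (e κ u) ∂uniformBoxLaw d) / l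
        = ∫ u, (l / 2 * w κ + (w κ * log (w κ) - w κ * log (q (e κ u)) - w κ + q (e κ u)) / l)
          ∂uniformBoxLaw d := by
      rw [integral_add (integrable_const _) (hi6.div_const l), integral_div,
        integral_add hi5 (hqe κ), integral_sub hi4 (integrable_const _),
        integral_sub (integrable_const _) hi3]
      simp only [integral_const_mul, integral_const, probReal_univ, one_smul]
    rw [hL, hR]
    refine integral_mono (hi2.sub hi1) ((integrable_const _).add (hi6.div_const l)) fun u => ?_
    refine le_trans ?_ (max_sub_zero_le_klFun (hw0 κ) (hq0 (e κ u)) hl)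
    by_cases hu : e κ u ∈ B
    · have hu' : u ∈ e κ ⁻¹' B := hu
      simp [hu, hu']
    · have hu' : u ∉ e κ ⁻¹' B := hu
      simp only [Set.indicator_of_notMem hu, Set.indicator_of_notMem hu', sub_zero]
      exact le_max_right _ _
  have hsum := Finset.sum_le_sum fun κ (_ : κ ∈ piAntidiag univ n) => hbox κ
  rw [Finset.sum_sub_distrib, Finset.sum_add_distrib, ← Finset.mul_sum, hW, ← Finset.sum_div,
    Finset.sum_add_distrib, Finset.sum_sub_distrib, hW] at hsum
  have hKL := sum_multinomialWeight_mul_log_sub_le hn hp hτ hpτ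
  have hdiv : (∑ κ ∈ piAntidiag univ n, (w κ * log (w κ)
      - w κ * ∫ u, log (q (e κ u)) ∂uniformBoxLaw d) - 1
      + ∑ κ ∈ piAntidiag univ n, ∫ u, q (e κ u) ∂uniformBoxLaw d) / l
      ≤ ((d + 1) * τ ^ 3 / n) / l := by
    gcongr
    have : ∑ κ ∈ piAntidiag univ n, (w κ * log (w κ)
      - w κ * ∫ u, log (q (e κ u)) ∂uniformBoxLaw d) ≤ (d + 1) * τ ^ 3 / n := hKL
    linarith
  have hgoal : ∑ κ ∈ piAntidiag univ n, w κ * (uniformBoxLaw d).real (e κ ⁻¹' B)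
      - (gaussLaw d n p).real B ≤ l / 2 + ((d + 1) * τ ^ 3 / n) / l := by
    linarith
  exact hgoal

/-- **Proposition 2 (Total variation bound).** -/
theorem stmt2 (d : ℕ) (τ : ℝ) (hτ : (d : ℝ) + 1 ≤ τ) (n : ℕ) (hn : τ ^ 4 ≤ (n : ℝ))
    (p : Fin d → ℝ) (hp : p ∈ Ptau d τ)
    {Ω : Type*} [MeasurableSpace Ω] (Pr : Measure Ω) [IsProbabilityMeasure Pr]
    (K U : Ω → Fin d → ℝ) (hKm : Measurable K) (hUm : Measurable U)
    (hK : Measure.map K Pr = multinomialLaw d n p)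
    (hU : Measure.map U Pr = uniformBoxLaw d)
    (hind : ProbabilityTheory.IndepFun K U Pr)
    (Ptilde Q : Measure (Fin d → ℝ)) [IsFiniteMeasure Ptilde] [IsFiniteMeasure Q]
    (hPt : Ptilde = Measure.map (fun ω => K ω + U ω) Pr)
    (hQ : Q = gaussLaw d n p) :
    (Ptilde.toSignedMeasure - Q.toSignedMeasure).totalVariation Set.univ ≤
      ENNReal.ofReal (8.03 * τ ^ ((3 : ℝ) / 2) * ((d : ℝ) + 1) ^ ((1 : ℝ) / 2) /
        (n : ℝ) ^ ((1 : ℝ) / 2)) := by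
  have hd : (0 : ℝ) ≤ d := Nat.cast_nonneg d
  have hτ1 : 1 ≤ τ := by linarith
  have hn1 : (1 : ℝ) ≤ n := (one_le_pow₀ hτ1).trans hn
  have hn0 : n ≠ 0 := by
    rintro rfl
    norm_num at hn1
  have hpS := hp.1
  set r : ℝ := √(((d : ℝ) + 1) * τ ^ 3 / n) with hr
  have hr0 : 0 < r := Real.sqrt_pos.2 (by positivity)
  have hr2 : ((d : ℝ) + 1) * τ ^ 3 / n = r * r := (Real.mul_self_sqrt (by positivity)).symm
  have hreq : r = τ ^ ((3 : ℝ) / 2) * ((d : ℝ) + 1) ^ ((1 : ℝ) / 2) / (n : ℝ) ^ ((1 : ℝ) / 2) := by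
    rw [hr, Real.sqrt_eq_rpow, Real.div_rpow (by positivity) (by positivity),
      Real.mul_rpow (by positivity) (by positivity), ← Real.rpow_natCast_mul (by positivity)]
    norm_num
    ring
  have hPprob : IsProbabilityMeasure Ptilde := by
    rw [hPt]
    exact Measure.isProbabilityMeasure_map (by fun_prop)
  have hQ1 : Q.real Set.univ = 1 := by
    rw [hQ, gaussLaw_real_apply hn0 hpS MeasurableSet.univ]
    simpa using integral_normalDensity hn0 hpS
  refine (totalVariation_sub_le Ptilde Q (by rw [hQ1, probReal_univ]) (ε := 2 * r)
    fun B hB => ?_).trans (ENNReal.ofReal_le_ofReal ?_)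
  · have h := sum_box_sub_gaussLaw_le hn0 hpS hτ hp.2 (mul_pos two_pos hr0) hB
    rw [hr2, mul_div_mul_right _ _ hr0.ne'] at h
    rw [hPt, hQ, map_add_real_apply hpS Pr hKm hUm hK hU hind hB]
    linarith
  · have h : 8.03 * τ ^ ((3 : ℝ) / 2) * ((d : ℝ) + 1) ^ ((1 : ℝ) / 2) / (n : ℝ) ^ ((1 : ℝ) / 2)
        = 8.03 * r := by
      rw [hreq]
      ring
    rw [h]
    linarith
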